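/- Let α, ℓ > 0, take α_1 = … = α_d = α and ℓ_1 = … = ℓ_d = ℓ, and let N ≥ 1 satisfy N + 1 = (n+1)^d for some integer n ≥ 1. Then every N-point quadrature rule Q in ℝ^d satisfies e_{α,ℓ}(Q) ≥ C̄_n(γ)^d (N+1)^{−1} (ω_γ e/(4n))^{dn} ≥ C̄_n(γ)^d c^{−(N+1)^{1/d}} (N+1)^{−((N+1)^{1/d}+1)}, where γ = α/ℓ, ω_γ = 2γ²/(1 + 2γ² + √(1+4γ²)), C̄_n(γ) = √(2(1+4γ²)^{1/4}/((1+2γ²+√(1+4γ²)) e)) · (n!/(2n)!) · (e/(4n))^{−n}, and c = (4/(ω_γ e))^d > 1. -/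

import Mathlib

open MeasureTheory Real Filter

noncomputable section

/-- The orthonormal basis functions of the Gaussian RKHS. -/
def phi (ℓ : ℝ) (m : ℕ) (x : ℝ) : ℝ :=
  x ^ m * Real.exp (-x ^ 2 / (2 * ℓ ^ 2)) / (ℓ ^ m * Real.sqrt (Nat.factorial m))

/-- The univariate Gaussian integral functional. -/
def Igauss (α : ℝ) (f : ℝ → ℝ) : ℝ :=
  (Real.sqrt (2 * Real.pi) * α)⁻¹ * ∫ x : ℝ, f x * Real.exp (-x ^ 2 / (2 * α ^ 2))

/-- β = αℓ/√(α² + ℓ²). -/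
def betaP (α ℓ : ℝ) : ℝ := α * ℓ / Real.sqrt (α ^ 2 + ℓ ^ 2)

/-- C_n = 2^n n! n^{−1/4} / √((2n)!). -/
def Cseq (n : ℕ) : ℝ :=
  2 ^ n * (Nat.factorial n : ℝ) * (n : ℝ) ^ (-(1 / 4 : ℝ)) / Real.sqrt (Nat.factorial (2 * n))

/-- ω_γ = 2γ²/(1 + 2γ² + √(1+4γ²)). -/
def omegaP (γ : ℝ) : ℝ := 2 * γ ^ 2 / (1 + 2 * γ ^ 2 + Real.sqrt (1 + 4 * γ ^ 2))

/-- C̄_n(γ). -/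
def Cbar (γ : ℝ) (n : ℕ) : ℝ :=
  Real.sqrt (2 * (1 + 4 * γ ^ 2) ^ ((1 : ℝ) / 4) /
      ((1 + 2 * γ ^ 2 + Real.sqrt (1 + 4 * γ ^ 2)) * Real.exp 1)) *
    ((Nat.factorial n : ℝ) / (Nat.factorial (2 * n) : ℝ)) *
    (Real.exp 1 / (4 * (n : ℝ))) ^ (-(n : ℤ))

/-- `x`, `w` are the nodes and weights of the n-point Gauss–Hermite rule: the nodes are the
n distinct roots of the probabilists' Hermite polynomial H_n, the weights are positive, and
the rule integrates exactly all polynomials of degree at most 2n−1 against the standard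
Gaussian weight. -/
def IsGaussHermite (n : ℕ) (x w : Fin n → ℝ) : Prop :=
  Function.Injective x ∧
  (∀ i, Polynomial.aeval (x i) (Polynomial.hermite n) = 0) ∧
  (∀ i, 0 < w i) ∧
  ∀ p : Polynomial ℝ, p.natDegree ≤ 2 * n - 1 →
    ∑ i, w i * p.eval (x i)
      = (Real.sqrt (2 * Real.pi))⁻¹ * ∫ t : ℝ, p.eval t * Real.exp (-t ^ 2 / 2)

/-- The scaled Gauss–Hermite rule Q_{α,ℓ,n}^{GH}. -/
def QGH (α ℓ : ℝ) {n : ℕ} (x w : Fin n → ℝ) (f : ℝ → ℝ) : ℝ :=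
  betaP α ℓ / α *
    ∑ i, w i * Real.exp (betaP α ℓ ^ 2 * x i ^ 2 / (2 * ℓ ^ 2)) * f (betaP α ℓ * x i)

/-- Membership in the unit ball of the Gaussian RKHS H(K_ℓ). -/
def InBall (ℓ : ℝ) (f : ℝ → ℝ) : Prop :=
  ∃ c : ℕ → ℝ, (∀ x, HasSum (fun m => c m * phi ℓ m x) (f x)) ∧
    Summable (fun m => c m ^ 2) ∧ (∑' m, c m ^ 2) ≤ 1

/-- Worst-case error of a quadrature functional over the unit ball of H(K_ℓ). -/
def wce1 (α ℓ : ℝ) (Q : (ℝ → ℝ) → ℝ) : ℝ :=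
  sSup {e : ℝ | ∃ f : ℝ → ℝ, InBall ℓ f ∧ e = |Igauss α f - Q f|}

/-- The n-th minimal worst-case error (univariate). -/
def minErr1 (α ℓ : ℝ) (n : ℕ) : ℝ :=
  ⨅ p : (Fin n → ℝ) × (Fin n → ℝ), wce1 α ℓ fun f => ∑ i, p.2 i * f (p.1 i)

/-- The multivariate Gaussian integral functional. -/
def IgaussD {d : ℕ} (α : Fin d → ℝ) (f : (Fin d → ℝ) → ℝ) : ℝ :=
  ∫ x : Fin d → ℝ,
    f x * ∏ i, (Real.sqrt (2 * Real.pi) * α i)⁻¹ * Real.exp (-(x i) ^ 2 / (2 * α i ^ 2))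

/-- Membership in the unit ball of the tensor-product Gaussian RKHS H(K_ℓ), ℓ ∈ ℝ^d. -/
def InBallD {d : ℕ} (ℓ : Fin d → ℝ) (f : (Fin d → ℝ) → ℝ) : Prop :=
  ∃ c : (Fin d → ℕ) → ℝ,
    (∀ x, HasSum (fun m => c m * ∏ i, phi (ℓ i) (m i) (x i)) (f x)) ∧
    Summable (fun m => c m ^ 2) ∧ (∑' m, c m ^ 2) ≤ 1

/-- Worst-case error of a multivariate quadrature functional. -/
def wceD {d : ℕ} (α ℓ : Fin d → ℝ) (Q : ((Fin d → ℝ) → ℝ) → ℝ) : ℝ :=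
  sSup {e : ℝ | ∃ f, InBallD ℓ f ∧ e = |IgaussD α f - Q f|}

/-- The N-th minimal worst-case error in dimension d. -/
def minErrD {d : ℕ} (α ℓ : Fin d → ℝ) (N : ℕ) : ℝ :=
  ⨅ p : (Fin N → (Fin d → ℝ)) × (Fin N → ℝ), wceD α ℓ fun f => ∑ i, p.2 i * f (p.1 i)

/-- The tensor-product scaled Gauss–Hermite rule. -/
def QGHD {d : ℕ} (α ℓ : Fin d → ℝ) (n : Fin d → ℕ)
    (x w : ∀ j, Fin (n j) → ℝ) (f : (Fin d → ℝ) → ℝ) : ℝ :=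
  ∑ i : ∀ j, Fin (n j),
    (∏ j, betaP (α j) (ℓ j) / α j * w j (i j) *
        Real.exp (betaP (α j) (ℓ j) ^ 2 * x j (i j) ^ 2 / (2 * ℓ j ^ 2))) *
      f fun j => betaP (α j) (ℓ j) * x j (i j)

/-- The power function of a finite point set (univariate). -/
def power1 (ℓ : ℝ) (X : Finset ℝ) (x : ℝ) : ℝ :=
  sSup {v : ℝ | ∃ f, InBall ℓ f ∧ (∀ y ∈ X, f y = 0) ∧ v = f x}

/-- Fill distance of X on Ω (univariate). -/
def fillDist1 (X : Finset ℝ) (Ω : Set ℝ) : ℝ :=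
  sSup {h : ℝ | ∃ x ∈ Ω, h = sInf {r : ℝ | ∃ y ∈ X, y ∈ Ω ∧ r = |x - y|}}

/-- Euclidean distance on ℝ^d. -/
def eucDist {d : ℕ} (x y : Fin d → ℝ) : ℝ := Real.sqrt (∑ i, (x i - y i) ^ 2)

/-- The power function of a finite point set in ℝ^d for the isotropic Gaussian kernel. -/
def powerD {d : ℕ} (ℓ : ℝ) (X : Finset (Fin d → ℝ)) (x : Fin d → ℝ) : ℝ :=
  sSup {v : ℝ | ∃ f, InBallD (fun _ => ℓ) f ∧ (∀ y ∈ X, f y = 0) ∧ v = f x}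

/-- Fill distance of X on Ω ⊂ ℝ^d (Euclidean). -/
def fillDistD {d : ℕ} (X : Finset (Fin d → ℝ)) (Ω : Set (Fin d → ℝ)) : ℝ :=
  sSup {h : ℝ | ∃ x ∈ Ω, h = sInf {r : ℝ | ∃ y ∈ X, y ∈ Ω ∧ r = eucDist x y}}

/-- Worst-case error of the optimal-weight (kernel quadrature) rule with nodes X (univariate). -/
def eopt1 (α ℓ : ℝ) (X : Finset ℝ) : ℝ :=
  ⨅ w : ℝ → ℝ, wce1 α ℓ fun f => ∑ y ∈ X, w y * f y

/-- Worst-case error of the optimal-weight rule with nodes X ⊂ ℝ^d. -/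
def eoptD {d : ℕ} (α ℓ : Fin d → ℝ) (X : Finset (Fin d → ℝ)) : ℝ :=
  ⨅ w : (Fin d → ℝ) → ℝ, wceD α ℓ fun f => ∑ y ∈ X, w y * f y

/-- The point sets X_k = ∪_{m=1}^k (Y_{k−m+1}^{m,+} ∪ Y_{k−m+1}^{m,−}). -/
def Xk (Y : ℕ → Finset ℝ) (k : ℕ) : Finset ℝ :=
  (Finset.Icc 1 k).biUnion fun m =>
    ((Y (k - m + 1)).image fun x => x + (m : ℝ) - 1) ∪
      ((Y (k - m + 1)).image fun x => x - (m : ℝ))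



/-- The power series of `exp (b t² / 2)`. -/
def gaussSeries (b : ℝ) : PowerSeries ℝ :=
  PowerSeries.mk fun i => if Even i then (b / 2) ^ (i / 2) / (Nat.factorial (i / 2) : ℝ) else 0

lemma coeff_gaussSeries_two_mul (b : ℝ) (j : ℕ) :
    PowerSeries.coeff (2 * j) (gaussSeries b) = (b / 2) ^ j / (Nat.factorial j : ℝ) := by
  simp [gaussSeries]

lemma coeff_gaussSeries_two_mul_add_one (b : ℝ) (j : ℕ) :
    PowerSeries.coeff (2 * j + 1) (gaussSeries b) = 0 := by
  simp [gaussSeries]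

lemma coeff_gaussSeries_add_two (b : ℝ) (i : ℕ) :
    PowerSeries.coeff (i + 2) (gaussSeries b) * ((i : ℝ) + 2)
      = b * PowerSeries.coeff i (gaussSeries b) := by
  obtain ⟨j, rfl | rfl⟩ := Nat.even_or_odd' i
  · rw [show 2 * j + 2 = 2 * (j + 1) by ring, coeff_gaussSeries_two_mul,
      coeff_gaussSeries_two_mul, Nat.factorial_succ, pow_succ]
    push_cast
    field_simp
  · rw [show 2 * j + 1 + 2 = 2 * (j + 1) + 1 by ring, coeff_gaussSeries_two_mul_add_one,
      coeff_gaussSeries_two_mul_add_one]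
    simp

lemma derivative_gaussSeries (b : ℝ) :
    PowerSeries.derivative ℝ (gaussSeries b)
      = PowerSeries.C b * (PowerSeries.X * gaussSeries b) := by
  ext i
  rw [PowerSeries.coeff_derivative, PowerSeries.coeff_C_mul]
  cases i with
  | zero =>
    have := coeff_gaussSeries_two_mul_add_one b 0
    simp_all
  | succ i =>
    rw [PowerSeries.coeff_succ_X_mul, ← coeff_gaussSeries_add_two]
    push_cast
    ring

lemma coeff_gaussSeries_sq_mul_factorial_le {b : ℝ} (i : ℕ) :
    PowerSeries.coeff i (gaussSeries b) ^ 2 * (Nat.factorial i : ℝ) ≤ |b| ^ i := by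
  induction i using Nat.twoStepInduction with
  | zero => simp [show PowerSeries.coeff 0 (gaussSeries b) = 1 by
      simpa using coeff_gaussSeries_two_mul b 0, -PowerSeries.coeff_zero_eq_constantCoeff]
  | one => simp [show PowerSeries.coeff 1 (gaussSeries b) = 0 from
      coeff_gaussSeries_two_mul_add_one b 0]
  | more i ih _ =>
    have h := coeff_gaussSeries_add_two b i
    set p := PowerSeries.coeff (i + 2) (gaussSeries b)
    set q := PowerSeries.coeff i (gaussSeries b)
    rw [Nat.factorial_succ, Nat.factorial_succ]
    push_cast
    have hp : p = b * q / ((i : ℝ) + 2) := by field_simp; linarith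
    have hi : ((i : ℝ) + 1) / ((i : ℝ) + 2) ≤ 1 := by
      rw [div_le_one (by positivity)]; linarith
    calc p ^ 2 * (((i : ℝ) + 1 + 1) * (((i : ℝ) + 1) * (Nat.factorial i : ℝ)))
        = |b| ^ 2 * (q ^ 2 * (Nat.factorial i : ℝ)) * (((i : ℝ) + 1) / ((i : ℝ) + 2)) := by
          rw [hp, sq_abs]; field_simp; ring
      _ ≤ |b| ^ 2 * |b| ^ i * 1 := by gcongr
      _ = |b| ^ (i + 2) := by ring

/-- Power series all of whose derivatives have finite Fock norm. -/
def FockAdm (F : PowerSeries ℝ) : Prop :=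
  ∀ k : ℕ, Summable fun i => PowerSeries.coeff i F ^ 2 * (Nat.factorial (i + k) : ℝ)

lemma FockAdm.add {F G : PowerSeries ℝ} (hF : FockAdm F) (hG : FockAdm G) : FockAdm (F + G) := by
  intro k
  refine Summable.of_nonneg_of_le (fun i => by positivity) (fun i => ?_)
    (((hF k).add (hG k)).mul_left 2)
  rw [map_add, ← add_mul, ← mul_assoc]
  gcongr
  nlinarith [sq_nonneg (PowerSeries.coeff i F - PowerSeries.coeff i G)]

lemma FockAdm.C_mul {F : PowerSeries ℝ} (hF : FockAdm F) (a : ℝ) :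
    FockAdm (PowerSeries.C a * F) := by
  intro k
  refine ((hF k).mul_left (a ^ 2)).congr fun i => ?_
  rw [PowerSeries.coeff_C_mul]
  ring

lemma FockAdm.X_mul {F : PowerSeries ℝ} (hF : FockAdm F) : FockAdm (PowerSeries.X * F) := by
  intro k
  rw [← summable_nat_add_iff 1]
  refine (hF (k + 1)).congr fun i => ?_
  rw [PowerSeries.coeff_succ_X_mul, add_right_comm, add_assoc]

lemma FockAdm.derivative {F : PowerSeries ℝ} (hF : FockAdm F) :
    FockAdm (PowerSeries.derivative ℝ F) := by
  intro k
  refine Summable.of_nonneg_of_le (fun i => by positivity) (fun i => ?_)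
    ((summable_nat_add_iff 1).2 (hF (k + 1)))
  rw [PowerSeries.coeff_derivative, show i + 1 + (k + 1) = i + k + 1 + 1 by ring,
    Nat.factorial_succ, Nat.factorial_succ, mul_pow, mul_assoc]
  push_cast
  have : ((i : ℝ) + 1) ^ 2 ≤ ((i : ℝ) + k + 1 + 1) * ((i : ℝ) + k + 1) := by
    nlinarith [Nat.cast_nonneg (α := ℝ) i, Nat.cast_nonneg (α := ℝ) k]
  rw [← mul_assoc (_ + 1 : ℝ)]
  gcongr

lemma fockAdm_gaussSeries {b : ℝ} (hb : |b| < 1) : FockAdm (gaussSeries b) := by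
  intro k
  have hs := (summable_choose_mul_geometric_of_norm_lt_one k (r := |b|) (by simpa)).mul_left
    (Nat.factorial k : ℝ)
  refine Summable.of_nonneg_of_le (fun i => by positivity) (fun i => ?_) hs
  have h : (Nat.factorial (i + k) : ℝ)
      = Nat.factorial k * (Nat.choose (i + k) k) * Nat.factorial i := by
    rw [← Nat.choose_mul_factorial_mul_factorial (Nat.le_add_left k i), Nat.add_sub_cancel]
    push_cast
    ring
  calc _ = (Nat.factorial k * (Nat.choose (i + k) k : ℝ)) *
        (PowerSeries.coeff i (gaussSeries b) ^ 2 * (Nat.factorial i : ℝ)) := by rw [h]; ring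
    _ ≤ (Nat.factorial k * (Nat.choose (i + k) k : ℝ)) * |b| ^ i := by
        gcongr
        exact coeff_gaussSeries_sq_mul_factorial_le i
    _ = _ := by ring

/-- The inner product of the real Fock space. -/
def fockInner (F G : PowerSeries ℝ) : ℝ :=
  ∑' i, PowerSeries.coeff i F * PowerSeries.coeff i G * (Nat.factorial i : ℝ)

lemma FockAdm.summable_mul {F G : PowerSeries ℝ} (hF : FockAdm F) (hG : FockAdm G) :
    Summable fun i => PowerSeries.coeff i F * PowerSeries.coeff i G * (Nat.factorial i : ℝ) := by
  refine Summable.of_norm_bounded ((hF 0).add (hG 0)) fun i => ?_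
  rw [norm_mul, norm_mul, ← add_mul, add_zero, Real.norm_natCast]
  gcongr
  rw [Real.norm_eq_abs, Real.norm_eq_abs, ← sq_abs (PowerSeries.coeff i F),
    ← sq_abs (PowerSeries.coeff i G)]
  nlinarith [sq_nonneg (|PowerSeries.coeff i F| - |PowerSeries.coeff i G|),
    sq_nonneg (|PowerSeries.coeff i F| + |PowerSeries.coeff i G|)]

lemma fockInner_add_left {F G H : PowerSeries ℝ} (hF : FockAdm F) (hG : FockAdm G)
    (hH : FockAdm H) : fockInner (F + G) H = fockInner F H + fockInner G H := by
  rw [fockInner, fockInner, fockInner, ← (hF.summable_mul hH).tsum_add (hG.summable_mul hH)]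
  simp only [map_add, add_mul]

lemma fockInner_C_mul_left (a : ℝ) (F G : PowerSeries ℝ) :
    fockInner (PowerSeries.C a * F) G = a * fockInner F G := by
  simp only [fockInner, PowerSeries.coeff_C_mul, mul_assoc, tsum_mul_left]

lemma fockInner_comm (F G : PowerSeries ℝ) : fockInner F G = fockInner G F := by
  simp only [fockInner, mul_comm (PowerSeries.coeff _ F)]

lemma fockInner_X_mul_left {F G : PowerSeries ℝ} (hF : FockAdm F) (hG : FockAdm G) :
    fockInner (PowerSeries.X * F) G = fockInner F (PowerSeries.derivative ℝ G) := by
  rw [fockInner, (hF.X_mul.summable_mul hG).tsum_eq_zero_add]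
  simp only [PowerSeries.coeff_zero_X_mul, zero_mul, zero_add, fockInner]
  refine tsum_congr fun i => ?_
  rw [PowerSeries.coeff_succ_X_mul, PowerSeries.coeff_derivative, Nat.factorial_succ]
  push_cast
  ring

lemma choose_mul_pow_eq_coeff_gaussSeries (b : ℝ) (j : ℕ) :
    Ring.choose ((1 / 2 : ℝ) + j - 1) j * (b ^ 2) ^ j
      = PowerSeries.coeff (2 * j) (gaussSeries b) * PowerSeries.coeff (2 * j) (gaussSeries b) *
        (Nat.factorial (2 * j) : ℝ) := by
  rw [← Ring.multichoose_eq, coeff_gaussSeries_two_mul]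
  have h1 := Ring.factorial_nsmul_multichoose_eq_ascPochhammer (1 / 2 : ℝ) j
  rw [nsmul_eq_mul, Polynomial.ascPochhammer_smeval_eq_eval] at h1
  have h2 : (ascPochhammer ℝ j).eval (1 / 2) * 4 ^ j * (Nat.factorial j : ℝ)
      = (Nat.factorial (2 * j) : ℝ) := by
    clear h1
    induction j with
    | zero => simp
    | succ j ih =>
      rw [ascPochhammer_succ_eval, show 2 * (j + 1) = 2 * j + 1 + 1 by ring,
        Nat.factorial_succ, Nat.factorial_succ, Nat.factorial_succ, pow_succ]
      push_cast
      rw [← ih]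
      ring
  rw [← h2, ← h1, ← pow_mul, mul_comm 2 j, pow_mul, div_pow]
  have : (4 : ℝ) ^ j = 2 ^ j * 2 ^ j := by rw [← mul_pow]; norm_num
  rw [this]
  field_simp

lemma fockInner_gaussSeries_self {b : ℝ} (hb : |b| < 1) :
    fockInner (gaussSeries b) (gaussSeries b) = 1 / (1 - b ^ 2) ^ (1 / 2 : ℝ) := by
  have hb2 : b ^ 2 ∈ Metric.eball (0 : ℝ) 1 := by
    rw [← ENNReal.ofReal_one, Metric.eball_ofReal, mem_ball_zero_iff, norm_pow]
    exact pow_lt_one₀ (norm_nonneg b) hb two_ne_zero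
  have h := (Real.one_div_one_sub_rpow_hasFPowerSeriesOnBall_zero (1 / 2)).hasSum hb2
  simp only [zero_add, FormalMultilinearSeries.ofScalars_apply_eq, smul_eq_mul,
    choose_mul_pow_eq_coeff_gaussSeries] at h
  have hodd : HasSum (fun j => PowerSeries.coeff (2 * j + 1) (gaussSeries b) *
      PowerSeries.coeff (2 * j + 1) (gaussSeries b) * (Nat.factorial (2 * j + 1) : ℝ)) 0 := by
    simp [coeff_gaussSeries_two_mul_add_one]
  have := HasSum.even_add_odd (f := fun i => PowerSeries.coeff i (gaussSeries b) *
    PowerSeries.coeff i (gaussSeries b) * (Nat.factorial i : ℝ)) h hodd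
  rw [fockInner, this.tsum_eq, add_zero]

lemma hasSum_gaussSeries (b t : ℝ) :
    HasSum (fun i => PowerSeries.coeff i (gaussSeries b) * t ^ i) (Real.exp (b * t ^ 2 / 2)) := by
  have h := NormedSpace.expSeries_div_hasSum_exp (b * t ^ 2 / 2)
  rw [← Real.exp_eq_exp_ℝ] at h
  have heven : HasSum (fun j => PowerSeries.coeff (2 * j) (gaussSeries b) * t ^ (2 * j))
      (Real.exp (b * t ^ 2 / 2)) := by
    have e : (fun j => PowerSeries.coeff (2 * j) (gaussSeries b) * t ^ (2 * j))
        = fun j => (b * t ^ 2 / 2) ^ j / (Nat.factorial j : ℝ) := by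
      funext j
      rw [coeff_gaussSeries_two_mul, pow_mul, mul_div_right_comm b, mul_pow, mul_div_right_comm]
    rw [e]
    exact h
  have hodd : HasSum (fun j => PowerSeries.coeff (2 * j + 1) (gaussSeries b) * t ^ (2 * j + 1))
      0 := by
    simp [coeff_gaussSeries_two_mul_add_one]
  simpa using HasSum.even_add_odd (f := fun i => PowerSeries.coeff i (gaussSeries b) * t ^ i)
    heven hodd

/-- The power series of `p (c t) * exp (b t² / 2)`. -/
def polyGauss (b c : ℝ) (p : Polynomial ℝ) : PowerSeries ℝ :=
  Polynomial.aeval (PowerSeries.C c * PowerSeries.X) p * gaussSeries b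

lemma polyGauss_add (b c : ℝ) (p q : Polynomial ℝ) :
    polyGauss b c (p + q) = polyGauss b c p + polyGauss b c q := by
  simp [polyGauss, add_mul]

lemma polyGauss_C_mul (b c a : ℝ) (p : Polynomial ℝ) :
    polyGauss b c (Polynomial.C a * p) = PowerSeries.C a * polyGauss b c p := by
  simp only [polyGauss, map_mul, Polynomial.aeval_C, mul_assoc]
  rfl

lemma polyGauss_X_mul (b c : ℝ) (p : Polynomial ℝ) :
    polyGauss b c (Polynomial.X * p)
      = PowerSeries.C c * (PowerSeries.X * polyGauss b c p) := by
  simp only [polyGauss, map_mul, Polynomial.aeval_X, mul_assoc]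

lemma polyGauss_one (b c : ℝ) : polyGauss b c 1 = gaussSeries b := by
  simp [polyGauss]

lemma derivative_polyGauss (b c : ℝ) (p : Polynomial ℝ) :
    PowerSeries.derivative ℝ (polyGauss b c p)
      = PowerSeries.C c * polyGauss b c (Polynomial.derivative p)
        + PowerSeries.C b * (PowerSeries.X * polyGauss b c p) := by
  simp only [polyGauss, Derivation.leibniz, Derivation.map_aeval, derivative_gaussSeries,
    smul_eq_mul, PowerSeries.derivative_C, PowerSeries.derivative_X]
  ring

/-- Induction on polynomials built from constants, sums and multiplication by `X`. -/
lemma polynomial_induction_X_mul {P : Polynomial ℝ → Prop} (one : P 1)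
    (add : ∀ p q, P p → P q → P (p + q)) (C_mul : ∀ a p, P p → P (Polynomial.C a * p))
    (X_mul : ∀ p, P p → P (Polynomial.X * p)) (p : Polynomial ℝ) : P p := by
  induction p using Polynomial.induction_on with
  | C a => simpa using C_mul a 1 one
  | add p q hp hq => exact add p q hp hq
  | monomial n a ih =>
    rw [pow_succ', mul_left_comm]
    exact X_mul _ ih

lemma fockAdm_polyGauss {b : ℝ} (hb : |b| < 1) (c : ℝ) (p : Polynomial ℝ) :
    FockAdm (polyGauss b c p) := by
  induction p using polynomial_induction_X_mul with
  | one => rw [polyGauss_one]; exact fockAdm_gaussSeries hb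
  | add p q hp hq => rw [polyGauss_add]; exact hp.add hq
  | C_mul a p hp => rw [polyGauss_C_mul]; exact hp.C_mul a
  | X_mul p hp => rw [polyGauss_X_mul]; exact hp.X_mul.C_mul c

lemma hasSum_polyGauss (b c t : ℝ) (p : Polynomial ℝ) :
    HasSum (fun i => PowerSeries.coeff i (polyGauss b c p) * t ^ i)
      (p.eval (c * t) * Real.exp (b * t ^ 2 / 2)) := by
  induction p using polynomial_induction_X_mul with
  | one => simpa [polyGauss_one] using hasSum_gaussSeries b t
  | add p q hp hq =>
    simpa only [polyGauss_add, map_add, add_mul, Polynomial.eval_add] using hp.add hq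
  | C_mul a p hp =>
    simpa only [polyGauss_C_mul, PowerSeries.coeff_C_mul, Polynomial.eval_mul,
      Polynomial.eval_C, mul_assoc] using hp.mul_left a
  | X_mul p hp =>
    rw [← hasSum_nat_add_iff' 1]
    simp only [polyGauss_X_mul, PowerSeries.coeff_C_mul, PowerSeries.coeff_succ_X_mul,
      Polynomial.eval_mul, Polynomial.eval_X, Finset.range_one, Finset.sum_singleton,
      PowerSeries.coeff_zero_X_mul, mul_zero, zero_mul, sub_zero]
    have e : (fun i => c * PowerSeries.coeff i (polyGauss b c p) * t ^ (i + 1))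
        = fun i => c * t * (PowerSeries.coeff i (polyGauss b c p) * t ^ i) := by
      funext i
      ring
    rw [e, mul_assoc]
    exact hp.mul_left (c * t)

/-- The Hermite polynomials over the reals. -/
def hermiteR (n : ℕ) : Polynomial ℝ := (Polynomial.hermite n).map (Int.castRingHom ℝ)

lemma hermiteR_zero : hermiteR 0 = 1 := by simp [hermiteR]

lemma hermiteR_succ (n : ℕ) :
    hermiteR (n + 1) = Polynomial.X * hermiteR n - Polynomial.derivative (hermiteR n) := by
  simp [hermiteR, Polynomial.hermite_succ, Polynomial.derivative_map]

lemma derivative_hermiteR_succ (n : ℕ) :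
    Polynomial.derivative (hermiteR (n + 1)) = Polynomial.C ((n : ℝ) + 1) * hermiteR n := by
  induction n with
  | zero => simp [hermiteR_succ, hermiteR_zero]
  | succ n ih =>
    rw [hermiteR_succ (n + 1), Polynomial.derivative_sub, Polynomial.derivative_mul, ih,
      Polynomial.derivative_X, Polynomial.derivative_mul, Polynomial.derivative_C,
      hermiteR_succ n]
    push_cast
    simp only [map_add, map_one]
    ring

lemma derivative_hermiteR (n : ℕ) :
    Polynomial.derivative (hermiteR n) = Polynomial.C (n : ℝ) * hermiteR (n - 1) := by
  cases n with
  | zero => simp [hermiteR_zero]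
  | succ n => rw [derivative_hermiteR_succ]; simp

lemma hermiteR_mul_hermiteR (j k : ℕ) :
    hermiteR j * hermiteR k = ∑ r ∈ Finset.range (j + 1),
      Polynomial.C ((j.choose r : ℝ) * (k.descFactorial r : ℝ)) * hermiteR (j + k - 2 * r) := by
  induction j generalizing k with
  | zero => simp [hermiteR_zero]
  | succ j ih =>
    have h1 : hermiteR (j + 1) * hermiteR k
        = (Polynomial.X * (hermiteR j * hermiteR k)
            - Polynomial.derivative (hermiteR j * hermiteR k))
          + Polynomial.C (k : ℝ) * (hermiteR j * hermiteR (k - 1)) := by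
      rw [Polynomial.derivative_mul, derivative_hermiteR k, hermiteR_succ]
      ring
    have h2 : ∀ r ∈ Finset.range (j + 1), Polynomial.X *
        (Polynomial.C ((j.choose r : ℝ) * (k.descFactorial r : ℝ)) * hermiteR (j + k - 2 * r))
        - Polynomial.derivative
          (Polynomial.C ((j.choose r : ℝ) * (k.descFactorial r : ℝ)) * hermiteR (j + k - 2 * r))
        = Polynomial.C ((j.choose r : ℝ) * (k.descFactorial r : ℝ))
          * hermiteR (j + 1 + k - 2 * r) := by
      intro r hr
      rcases lt_or_ge k r with hkr | hkr
      · simp [Nat.descFactorial_of_lt hkr]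
      · have hr' := Finset.mem_range.1 hr
        rw [show j + 1 + k - 2 * r = j + k - 2 * r + 1 by omega, hermiteR_succ,
          Polynomial.derivative_C_mul]
        ring
    have h3 : Polynomial.C (k : ℝ) * (hermiteR j * hermiteR (k - 1))
        = ∑ r ∈ Finset.range (j + 1),
          Polynomial.C ((j.choose r : ℝ) * (k.descFactorial (r + 1) : ℝ))
            * hermiteR (j + 1 + k - 2 * (r + 1)) := by
      rw [ih, Finset.mul_sum]
      refine Finset.sum_congr rfl fun r _ => ?_
      cases k with
      | zero => simp
      | succ k =>
        have e : j + (k + 1 - 1) - 2 * r = j + 1 + (k + 1) - 2 * (r + 1) := by omega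
        rw [Nat.succ_descFactorial_succ, ← mul_assoc, ← Polynomial.C_mul, e, Nat.add_sub_cancel]
        congr 2
        push_cast
        ring
    rw [h1, ih, Finset.mul_sum, Polynomial.derivative_sum, ← Finset.sum_sub_distrib,
      Finset.sum_congr rfl h2, h3, Finset.sum_range_succ' _ (j + 1),
      Finset.sum_range_succ' (fun r => Polynomial.C ((j.choose r : ℝ) * (k.descFactorial r : ℝ))
        * hermiteR (j + 1 + k - 2 * r)) j,
      show ∑ r ∈ Finset.range (j + 1), Polynomial.C (((j + 1).choose (r + 1) : ℝ)
          * (k.descFactorial (r + 1) : ℝ)) * hermiteR (j + 1 + k - 2 * (r + 1))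
        = ∑ r ∈ Finset.range (j + 1), Polynomial.C ((j.choose r : ℝ)
          * (k.descFactorial (r + 1) : ℝ)) * hermiteR (j + 1 + k - 2 * (r + 1))
        + ∑ r ∈ Finset.range (j + 1), Polynomial.C ((j.choose (r + 1) : ℝ)
          * (k.descFactorial (r + 1) : ℝ)) * hermiteR (j + 1 + k - 2 * (r + 1)) by
        rw [← Finset.sum_add_distrib]
        refine Finset.sum_congr rfl fun r _ => ?_
        rw [← add_mul, ← Polynomial.C_add, Nat.choose_succ_succ, Nat.cast_add, add_mul],
      Finset.sum_range_succ (fun r => Polynomial.C ((j.choose (r + 1) : ℝ)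
          * (k.descFactorial (r + 1) : ℝ)) * hermiteR (j + 1 + k - 2 * (r + 1))) j]
    simp
    ring

lemma fockInner_polyGauss_raise {b c : ℝ} (hb0 : 0 < b) (hb : |b| < 1)
    (hc : b * c ^ 2 = 1 - b ^ 2) (p q : Polynomial ℝ) :
    b * fockInner (polyGauss b c (Polynomial.X * p - Polynomial.derivative p)) (polyGauss b c q)
      = fockInner (polyGauss b c p) (polyGauss b c (Polynomial.derivative q)) := by
  have hc0 : c ≠ 0 := by
    rintro rfl
    nlinarith [abs_lt.1 hb]
  have hp := fockAdm_polyGauss hb c p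
  have hq := fockAdm_polyGauss hb c q
  have hXp : FockAdm (PowerSeries.C (1 / (b * c)) * (PowerSeries.X * polyGauss b c p)) :=
    hp.X_mul.C_mul _
  have hdp : FockAdm (PowerSeries.C (-(1 / c)) * PowerSeries.derivative ℝ (polyGauss b c p)) :=
    hp.derivative.C_mul _
  have e1 : polyGauss b c (Polynomial.X * p - Polynomial.derivative p)
      = PowerSeries.C (1 / (b * c)) * (PowerSeries.X * polyGauss b c p)
        + PowerSeries.C (-(1 / c)) * PowerSeries.derivative ℝ (polyGauss b c p) := by
    have h1 : (PowerSeries.C (1 / c) * PowerSeries.C c : PowerSeries ℝ) = 1 := by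
      rw [← map_mul, one_div_mul_cancel hc0, map_one]
    have h2 : (PowerSeries.C c + PowerSeries.C (1 / c) * PowerSeries.C b : PowerSeries ℝ)
        = PowerSeries.C (1 / (b * c)) := by
      rw [← map_mul, ← map_add]
      congr 1
      field_simp
      linarith
    rw [show Polynomial.X * p - Polynomial.derivative p
        = Polynomial.X * p + Polynomial.C (-1) * Polynomial.derivative p by simp; ring,
      polyGauss_add, polyGauss_X_mul, polyGauss_C_mul, derivative_polyGauss, ← h2]
    simp only [map_neg, map_one]
    linear_combination (polyGauss b c (Polynomial.derivative p)) * h1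
  have e2 : PowerSeries.C c * polyGauss b c (Polynomial.derivative q)
      = PowerSeries.derivative ℝ (polyGauss b c q)
        + PowerSeries.C (-b) * (PowerSeries.X * polyGauss b c q) := by
    rw [derivative_polyGauss, map_neg]
    ring
  have e3 : c * fockInner (polyGauss b c p) (polyGauss b c (Polynomial.derivative q))
      = fockInner (polyGauss b c p) (PowerSeries.derivative ℝ (polyGauss b c q))
        - b * fockInner (polyGauss b c p) (PowerSeries.X * polyGauss b c q) := by
    rw [fockInner_comm, ← fockInner_C_mul_left, e2,
      fockInner_add_left hq.derivative (hq.X_mul.C_mul _) hp, fockInner_C_mul_left,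
      fockInner_comm (polyGauss b c p), fockInner_comm (polyGauss b c p)]
    ring
  rw [e1, fockInner_add_left hXp hdp hq, fockInner_C_mul_left, fockInner_C_mul_left,
    fockInner_X_mul_left hp hq, fockInner_comm (PowerSeries.derivative ℝ _),
    ← fockInner_X_mul_left hq hp, fockInner_comm (_ * polyGauss b c q)]
  rw [← mul_right_inj' hc0, e3]
  field_simp
  ring

lemma fockInner_hermiteR_self {b c : ℝ} (hb0 : 0 < b) (hb : |b| < 1)
    (hc : b * c ^ 2 = 1 - b ^ 2) (m : ℕ) :
    fockInner (polyGauss b c (hermiteR m)) (polyGauss b c (hermiteR m))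
      = (Nat.factorial m : ℝ) / b ^ m / (1 - b ^ 2) ^ (1 / 2 : ℝ) := by
  induction m with
  | zero => simp [hermiteR_zero, polyGauss_one, fockInner_gaussSeries_self hb]
  | succ m ih =>
    have h := fockInner_polyGauss_raise hb0 hb hc (hermiteR m) (hermiteR (m + 1))
    rw [← hermiteR_succ, derivative_hermiteR_succ, polyGauss_C_mul, fockInner_comm _
      (_ * _), fockInner_C_mul_left, ih] at h
    rw [← mul_right_inj' hb0.ne', h, Nat.factorial_succ, pow_succ]
    push_cast
    field_simp
    ring

/-- `f` has an expansion in the functions `Φ i` with coefficients of `ℓ²` norm at most `B`. -/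
def ExpansionBound {ι X : Type*} (Φ : ι → X → ℝ) (f : X → ℝ) (B : ℝ) : Prop :=
  ∃ c : lp (fun _ : ι => ℝ) 2, (∀ x, HasSum (fun i => c i * Φ i x) (f x)) ∧ ‖c‖ ≤ B

lemma ExpansionBound.congr {ι X : Type*} {Φ : ι → X → ℝ} {f g : X → ℝ} {B : ℝ}
    (hf : ExpansionBound Φ f B) (h : ∀ x, f x = g x) : ExpansionBound Φ g B :=
  funext h ▸ hf

lemma ExpansionBound.mono {ι X : Type*} {Φ : ι → X → ℝ} {f : X → ℝ} {B B' : ℝ}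
    (hf : ExpansionBound Φ f B) (h : B ≤ B') : ExpansionBound Φ f B' :=
  let ⟨c, hc, hB⟩ := hf
  ⟨c, hc, hB.trans h⟩

lemma ExpansionBound.const_mul {ι X : Type*} {Φ : ι → X → ℝ} {f : X → ℝ} {B : ℝ}
    (hf : ExpansionBound Φ f B) (a : ℝ) : ExpansionBound Φ (fun x => a * f x) (|a| * B) := by
  obtain ⟨c, hc, hB⟩ := hf
  refine ⟨a • c, fun x => ?_, ?_⟩
  · simpa [mul_assoc] using (hc x).mul_left a
  · rw [norm_smul, Real.norm_eq_abs]
    gcongr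

lemma ExpansionBound.sum {ι X κ : Type*} {Φ : ι → X → ℝ} {f : κ → X → ℝ} {B : κ → ℝ}
    (s : Finset κ) (hf : ∀ k ∈ s, ExpansionBound Φ (f k) (B k)) :
    ExpansionBound Φ (fun x => ∑ k ∈ s, f k x) (∑ k ∈ s, B k) := by
  classical
  induction s using Finset.induction_on with
  | empty => exact ⟨0, fun x => by simp, by simp⟩
  | insert k s hk ih =>
    obtain ⟨c, hc, hB⟩ := hf k (Finset.mem_insert_self k s)
    obtain ⟨c', hc', hB'⟩ := ih fun i hi => hf i (Finset.mem_insert_of_mem hi)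
    simp only [Finset.sum_insert hk]
    refine ⟨c + c', fun x => ?_, (norm_add_le c c').trans (add_le_add hB hB')⟩
    simpa [add_mul] using (hc x).add (hc' x)

lemma lp_two_norm_sq {ι : Type*} (c : lp (fun _ : ι => ℝ) 2) :
    HasSum (fun i => c i ^ 2) (‖c‖ ^ 2) := by
  have h := lp.hasSum_norm (p := 2) (by simp) c
  simpa using h

lemma expansionBound_of_summable {ι X : Type*} {Φ : ι → X → ℝ} {f : X → ℝ} {S : ℝ} (c : ι → ℝ)
    (hc : ∀ x, HasSum (fun i => c i * Φ i x) (f x)) (hS : HasSum (fun i => c i ^ 2) S) :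
    ExpansionBound Φ f (Real.sqrt S) := by
  have hmem : Memℓp c 2 := memℓp_gen (by simpa using hS.summable)
  refine ⟨⟨c, hmem⟩, hc, ?_⟩
  have h := lp_two_norm_sq (⟨c, hmem⟩ : lp (fun _ : ι => ℝ) 2)
  rw [hS.unique h, Real.sqrt_sq (norm_nonneg _)]

lemma hasSum_mul_prod {ι κ : Type*} {f : ι → ℝ} {g : κ → ℝ} {s t : ℝ} (hf : HasSum f s)
    (hg : HasSum g t) : HasSum (fun p : ι × κ => f p.1 * g p.2) (s * t) :=
  hf.mul hg (summable_mul_of_summable_norm hf.summable.norm hg.summable.norm)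

lemma hasSum_pi_prod {d : ℕ} (f : Fin d → ℕ → ℝ) (s : Fin d → ℝ)
    (h : ∀ i, HasSum (f i) (s i)) :
    HasSum (fun m : Fin d → ℕ => ∏ i, f i (m i)) (∏ i, s i) := by
  induction d with
  | zero => simp
  | succ d ih =>
    have h1 := ih (fun i => f i.succ) (fun i => s i.succ) fun i => h i.succ
    have h2 := hasSum_mul_prod (h 0) h1
    rw [Fin.prod_univ_succ, ← (Fin.consEquiv fun _ => ℕ).hasSum_iff]
    refine h2.congr_fun fun p => ?_
    simp [Fin.prod_univ_succ]

lemma ExpansionBound.pi_prod {d : ℕ} {X : Type*} {Φ : Fin d → ℕ → X → ℝ} {f : Fin d → X → ℝ}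
    {B : Fin d → ℝ} (hf : ∀ i, ExpansionBound (Φ i) (f i) (B i)) :
    ExpansionBound (fun (m : Fin d → ℕ) (x : Fin d → X) => ∏ i, Φ i (m i) (x i))
      (fun x => ∏ i, f i (x i)) (∏ i, B i) := by
  choose c hc hB using hf
  have hS := hasSum_pi_prod (fun i k => c i k ^ 2) (fun i => ‖c i‖ ^ 2)
    fun i => lp_two_norm_sq (c i)
  have hS' : HasSum (fun m : Fin d → ℕ => (∏ i, c i (m i)) ^ 2) ((∏ i, ‖c i‖) ^ 2) := by
    simpa only [Finset.prod_pow] using hS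
  have hx : ∀ x : Fin d → X, HasSum (fun m : Fin d → ℕ =>
      (∏ i, c i (m i)) * ∏ i, Φ i (m i) (x i)) (∏ i, f i (x i)) := fun x => by
    simpa only [Finset.prod_mul_distrib] using
      hasSum_pi_prod (fun i k => c i k * Φ i k (x i)) (fun i => f i (x i)) fun i => hc i (x i)
  have h := expansionBound_of_summable _ hx hS'
  rw [Real.sqrt_sq (Finset.prod_nonneg fun i _ => norm_nonneg _)] at h
  exact h.mono (Finset.prod_le_prod (fun i _ => norm_nonneg _) fun i _ => hB i)

lemma ExpansionBound.inBallD {d : ℕ} {ℓ : Fin d → ℝ} {f : (Fin d → ℝ) → ℝ}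
    (hf : ExpansionBound (fun (m : Fin d → ℕ) (x : Fin d → ℝ) => ∏ i, phi (ℓ i) (m i) (x i)) f 1) :
    InBallD ℓ f := by
  obtain ⟨c, hc, hB⟩ := hf
  refine ⟨c, hc, (lp_two_norm_sq c).summable, ?_⟩
  rw [(lp_two_norm_sq c).tsum_eq]
  exact pow_le_one₀ (norm_nonneg c) hB

lemma hasSum_phi_sq {ℓ : ℝ} (hℓ : 0 < ℓ) (x : ℝ) : HasSum (fun m => phi ℓ m x ^ 2) 1 := by
  have h := NormedSpace.expSeries_div_hasSum_exp ((x / ℓ) ^ 2)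
  rw [← Real.exp_eq_exp_ℝ] at h
  have h1 := h.mul_right (Real.exp (-(x / ℓ) ^ 2))
  rw [← Real.exp_add, add_neg_cancel, Real.exp_zero] at h1
  have e : (fun m => phi ℓ m x ^ 2)
      = fun m => ((x / ℓ) ^ 2) ^ m / (Nat.factorial m : ℝ) * Real.exp (-(x / ℓ) ^ 2) := by
    funext m
    rw [phi, div_pow, mul_pow, mul_pow, Real.sq_sqrt (Nat.cast_nonneg _), ← Real.exp_nat_mul]
    rw [show ((2 : ℕ) : ℝ) * (-x ^ 2 / (2 * ℓ ^ 2)) = -(x / ℓ) ^ 2 by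
      push_cast; field_simp]
    rw [div_pow, div_pow]
    field_simp
    ring
  rwa [e]

lemma InBallD.abs_le_one {d : ℕ} {ℓ : Fin d → ℝ} (hℓ : ∀ i, 0 < ℓ i) {f : (Fin d → ℝ) → ℝ}
    (hf : InBallD ℓ f) (x : Fin d → ℝ) : |f x| ≤ 1 := by
  obtain ⟨c, hc, hs, h1⟩ := hf
  have hΦ := hasSum_pi_prod (fun i m => phi (ℓ i) m (x i) ^ 2) (fun _ => 1)
    fun i => hasSum_phi_sq (hℓ i) (x i)
  simp only [Finset.prod_pow, Finset.prod_const_one] at hΦ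
  have hplus := ((hs.hasSum.add hΦ).add ((hc x).mul_left 2)).nonneg fun m => by
    nlinarith [sq_nonneg (c m + ∏ i, phi (ℓ i) (m i) (x i))]
  have hminus := ((hs.hasSum.add hΦ).sub ((hc x).mul_left 2)).nonneg fun m => by
    nlinarith [sq_nonneg (c m - ∏ i, phi (ℓ i) (m i) (x i))]
  rw [abs_le]
  constructor <;> linarith

lemma expansionBound_phi_polyGauss {b ℓ : ℝ} (hb : |b| < 1) (hℓ : 0 < ℓ) (c : ℝ)
    (p : Polynomial ℝ) :
    ExpansionBound (phi ℓ)
      (fun x => p.eval (c * (x / ℓ)) * Real.exp (-((1 - b) * (x / ℓ) ^ 2) / 2))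
      (Real.sqrt (fockInner (polyGauss b c p) (polyGauss b c p))) := by
  have hp := fockAdm_polyGauss hb c p
  refine expansionBound_of_summable
    (fun i => PowerSeries.coeff i (polyGauss b c p) * Real.sqrt (Nat.factorial i : ℝ))
    (fun x => ?_) ?_
  · have h := (hasSum_polyGauss b c (x / ℓ) p).mul_right (Real.exp (-(x / ℓ) ^ 2 / 2))
    rw [mul_assoc, ← Real.exp_add, show b * (x / ℓ) ^ 2 / 2 + -(x / ℓ) ^ 2 / 2
      = -((1 - b) * (x / ℓ) ^ 2) / 2 by ring] at h
    have e : (fun i => PowerSeries.coeff i (polyGauss b c p) * Real.sqrt (Nat.factorial i : ℝ)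
          * phi ℓ i x)
        = fun i => PowerSeries.coeff i (polyGauss b c p) * (x / ℓ) ^ i
          * Real.exp (-(x / ℓ) ^ 2 / 2) := by
      funext i
      have hi : Real.sqrt (Nat.factorial i : ℝ) ≠ 0 :=
        (Real.sqrt_pos.2 (by positivity)).ne'
      rw [phi, show -x ^ 2 / (2 * ℓ ^ 2) = -(x / ℓ) ^ 2 / 2 by field_simp, div_pow x ℓ i]
      field_simp
    rwa [e]
  · have e : (fun i => (PowerSeries.coeff i (polyGauss b c p)
          * Real.sqrt (Nat.factorial i : ℝ)) ^ 2)
        = fun i => PowerSeries.coeff i (polyGauss b c p)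
          * PowerSeries.coeff i (polyGauss b c p) * (Nat.factorial i : ℝ) := by
      funext i
      rw [mul_pow, Real.sq_sqrt (Nat.cast_nonneg _), sq]
    rw [e]
    exact (hp.summable_mul hp).hasSum

lemma choose_mul_descFactorial_sq_le {j k r : ℕ} (hj : r ≤ j) (hk : r ≤ k) :
    (j.choose r * k.descFactorial r) ^ 2 * Nat.factorial (j + k - 2 * r)
      ≤ Nat.factorial j * Nat.factorial k *
        ((j.choose r * 2 ^ (j - r)) * (k.choose r * 2 ^ (k - r))) := by
  obtain ⟨a, rfl⟩ := Nat.exists_eq_add_of_le' hj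
  obtain ⟨c, rfl⟩ := Nat.exists_eq_add_of_le' hk
  have h0 : Nat.factorial (a + c) ≤ 2 ^ (a + c) * (Nat.factorial a * Nat.factorial c) := by
    rw [← Nat.add_choose_mul_factorial_mul_factorial a c, mul_assoc]
    exact Nat.mul_le_mul_right _ (Nat.choose_le_two_pow _ _)
  rw [show a + r + (c + r) - 2 * r = a + c by omega, Nat.descFactorial_eq_factorial_mul_choose,
    ← Nat.add_choose_mul_factorial_mul_factorial a r,
    ← Nat.add_choose_mul_factorial_mul_factorial c r, Nat.add_sub_cancel, Nat.add_sub_cancel]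
  calc _ = ((a + r).choose r * (c + r).choose r * Nat.factorial r) ^ 2
        * Nat.factorial (a + c) := by ring
    _ ≤ ((a + r).choose r * (c + r).choose r * Nat.factorial r) ^ 2
        * (2 ^ (a + c) * (Nat.factorial a * Nat.factorial c)) := Nat.mul_le_mul_left _ h0
    _ = _ := by ring

lemma sum_choose_mul_two_pow {j n : ℕ} (h : j ≤ n) :
    ∑ r ∈ Finset.range (n + 1), (j.choose r : ℝ) * 2 ^ (j - r) = 3 ^ j := by
  rw [← Finset.sum_subset (Finset.range_mono (Nat.succ_le_succ h))]
  · rw [show (3 : ℝ) = 1 + 2 by norm_num, add_pow]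
    exact Finset.sum_congr rfl fun r _ => by ring
  · intro r _ hr
    rw [Nat.choose_eq_zero_of_lt (by simpa using hr)]
    simp

lemma sum_hermite_linearization_le {b : ℝ} (hb0 : 0 < b) (hb : b ≤ 1) {j k n : ℕ} (hj : j ≤ n)
    (hk : k ≤ n) :
    ∑ r ∈ Finset.range (j + 1), (j.choose r : ℝ) * (k.descFactorial r : ℝ) *
        Real.sqrt ((Nat.factorial (j + k - 2 * r) : ℝ) / b ^ (j + k - 2 * r))
      ≤ Real.sqrt ((Nat.factorial j : ℝ) * Nat.factorial k) * (3 / b) ^ n := by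
  obtain ⟨A, hA⟩ : ∃ A : ℝ,
    A = Real.sqrt ((Nat.factorial j : ℝ) * Nat.factorial k) * (1 / b) ^ n := ⟨_, rfl⟩
  have hA0 : 0 ≤ A := by rw [hA]; positivity
  have hterm : ∀ r ∈ Finset.range (j + 1), (j.choose r : ℝ) * (k.descFactorial r : ℝ) *
        Real.sqrt ((Nat.factorial (j + k - 2 * r) : ℝ) / b ^ (j + k - 2 * r))
      ≤ A * (Real.sqrt ((j.choose r : ℝ) * 2 ^ (j - r)) *
          Real.sqrt ((k.choose r : ℝ) * 2 ^ (k - r))) := by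
    intro r hr
    have hrj : r ≤ j := Nat.lt_succ_iff.1 (Finset.mem_range.1 hr)
    rcases lt_or_ge k r with hkr | hkr
    · rw [Nat.descFactorial_of_lt hkr]
      simp only [Nat.cast_zero, mul_zero, zero_mul]
      positivity
    · refine abs_le_of_sq_le_sq' ?_ (by positivity) |>.2
      rw [mul_pow, mul_pow A, mul_pow (Real.sqrt _), hA, mul_pow (Real.sqrt _),
        Real.sq_sqrt (by positivity), Real.sq_sqrt (by positivity), Real.sq_sqrt (by positivity),
        Real.sq_sqrt (by positivity)]
      have h1 : ((j.choose r : ℝ) * (k.descFactorial r : ℝ)) ^ 2 *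
          (Nat.factorial (j + k - 2 * r) : ℝ) ≤ (Nat.factorial j : ℝ) * Nat.factorial k *
          (((j.choose r : ℝ) * 2 ^ (j - r)) * ((k.choose r : ℝ) * 2 ^ (k - r))) := by
        exact_mod_cast choose_mul_descFactorial_sq_le hrj hkr
      have h2 : 1 / b ^ (j + k - 2 * r) ≤ ((1 / b) ^ n) ^ 2 := by
        rw [← one_div_pow, ← pow_mul]
        exact pow_le_pow_right₀ (by rwa [le_div_iff₀ hb0, one_mul]) (by omega)
      calc _ = ((j.choose r : ℝ) * (k.descFactorial r : ℝ)) ^ 2 *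
            (Nat.factorial (j + k - 2 * r) : ℝ) * (1 / b ^ (j + k - 2 * r)) := by ring
        _ ≤ (Nat.factorial j : ℝ) * Nat.factorial k *
            (((j.choose r : ℝ) * 2 ^ (j - r)) * ((k.choose r : ℝ) * 2 ^ (k - r))) *
            ((1 / b) ^ n) ^ 2 := by gcongr
        _ = _ := by ring
  calc _ ≤ ∑ r ∈ Finset.range (j + 1), A * (Real.sqrt ((j.choose r : ℝ) * 2 ^ (j - r)) *
          Real.sqrt ((k.choose r : ℝ) * 2 ^ (k - r))) := Finset.sum_le_sum hterm
    _ ≤ ∑ r ∈ Finset.range (n + 1), A * (Real.sqrt ((j.choose r : ℝ) * 2 ^ (j - r)) *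
          Real.sqrt ((k.choose r : ℝ) * 2 ^ (k - r))) :=
        Finset.sum_le_sum_of_subset_of_nonneg (Finset.range_mono (Nat.succ_le_succ hj))
          fun _ _ _ => by positivity
    _ ≤ A * (Real.sqrt (3 ^ j) * Real.sqrt (3 ^ k)) := by
        rw [← Finset.mul_sum, ← sum_choose_mul_two_pow hj, ← sum_choose_mul_two_pow hk]
        gcongr
        exact Real.sum_sqrt_mul_sqrt_le _ (fun r => by positivity) (fun r => by positivity)
    _ ≤ A * (Real.sqrt (3 ^ n) * Real.sqrt (3 ^ n)) := by
        gcongr <;> norm_num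
    _ = _ := by
        rw [Real.mul_self_sqrt (by positivity), hA, div_pow, div_pow]
        ring

/-- The normalised product of two scaled Hermite polynomials and a Gaussian. -/
def hermProd (b c ℓ : ℝ) (j k : ℕ) (x : ℝ) : ℝ :=
  (Real.sqrt ((Nat.factorial j : ℝ) * Nat.factorial k))⁻¹ *
    ((hermiteR j * hermiteR k).eval (c * (x / ℓ)) * Real.exp (-((1 - b) * (x / ℓ) ^ 2) / 2))

lemma expansionBound_hermProd {b c ℓ : ℝ} (hb0 : 0 < b) (hb : b < 1)
    (hc : b * c ^ 2 = 1 - b ^ 2) (hℓ : 0 < ℓ) {j k n : ℕ} (hj : j ≤ n) (hk : k ≤ n) :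
    ExpansionBound (phi ℓ) (hermProd b c ℓ j k)
      ((3 / b) ^ n * Real.sqrt (1 / (1 - b ^ 2) ^ (1 / 2 : ℝ))) := by
  have hb' : |b| < 1 := by rwa [abs_of_pos hb0]
  set N0 := Real.sqrt (1 / (1 - b ^ 2) ^ (1 / 2 : ℝ))
  set q := Real.sqrt ((Nat.factorial j : ℝ) * Nat.factorial k)
  have hq : 0 < q := Real.sqrt_pos.2 (by positivity)
  have hm : ∀ m, ExpansionBound (phi ℓ) (fun x => (hermiteR m).eval (c * (x / ℓ))
      * Real.exp (-((1 - b) * (x / ℓ) ^ 2) / 2))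
      (Real.sqrt ((Nat.factorial m : ℝ) / b ^ m) * N0) := by
    intro m
    have h := expansionBound_phi_polyGauss hb' hℓ c (hermiteR m)
    rwa [fockInner_hermiteR_self hb0 hb' hc, div_eq_mul_one_div _ ((1 - b ^ 2) ^ (1 / 2 : ℝ)),
      Real.sqrt_mul (by positivity)] at h
  have h1 := (ExpansionBound.sum (Finset.range (j + 1)) fun r _ =>
    (hm (j + k - 2 * r)).const_mul ((j.choose r : ℝ) * (k.descFactorial r : ℝ))).const_mul q⁻¹
  refine (h1.congr fun x => ?_).mono ?_
  · rw [hermProd, hermiteR_mul_hermiteR, Polynomial.eval_finsetSum, Finset.sum_mul]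
    simp only [Polynomial.eval_mul, Polynomial.eval_C, mul_assoc]
    rfl
  · have h2 := sum_hermite_linearization_le hb0 hb.le hj hk
    rw [abs_of_pos (inv_pos.2 hq), inv_mul_le_iff₀ hq, ← mul_assoc]
    refine le_trans (le_of_eq ?_) (mul_le_mul_of_nonneg_right h2 (Real.sqrt_nonneg _))
    rw [Finset.sum_mul]
    refine Finset.sum_congr rfl fun r _ => ?_
    rw [abs_of_nonneg (by positivity), mul_assoc, mul_assoc, mul_assoc]

lemma integrable_polynomial_mul_exp (p : Polynomial ℝ) :
    Integrable fun z : ℝ => p.eval z * Real.exp (-z ^ 2 / 2) := by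
  induction p using Polynomial.induction_on' with
  | add p q hp hq =>
    simp only [Polynomial.eval_add, add_mul]
    exact hp.add hq
  | monomial k a =>
    have h := (integrable_rpow_mul_exp_neg_mul_sq (b := 1 / 2) (by norm_num) (s := k)
      (lt_of_lt_of_le (by norm_num) k.cast_nonneg)).const_mul a
    refine h.congr (ae_of_all _ fun z => ?_)
    simp only [Polynomial.eval_monomial, Real.rpow_natCast]
    rw [mul_assoc, show -(1 / 2) * z ^ 2 = -z ^ 2 / 2 by ring]

lemma integral_hermiteR_succ_mul (j : ℕ) (q : Polynomial ℝ) :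
    ∫ z : ℝ, (hermiteR (j + 1) * q).eval z * Real.exp (-z ^ 2 / 2)
      = ∫ z : ℝ, (hermiteR j * Polynomial.derivative q).eval z * Real.exp (-z ^ 2 / 2) := by
  rw [← sub_eq_zero, ← neg_eq_zero, neg_sub, ← integral_sub (integrable_polynomial_mul_exp _)
    (integrable_polynomial_mul_exp _)]
  refine integral_eq_zero_of_hasDerivAt_of_integrable
    (f := fun z => (hermiteR j * q).eval z * Real.exp (-z ^ 2 / 2)) (fun z => ?_)
    ((integrable_polynomial_mul_exp _).sub (integrable_polynomial_mul_exp _))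
    (integrable_polynomial_mul_exp _)
  have h1 : HasDerivAt (fun z : ℝ => -z ^ 2 / 2) (-z) z := by
    refine ((hasDerivAt_pow 2 z).neg.div_const 2).congr_deriv ?_
    simp
    ring
  refine (((hermiteR j * q).hasDerivAt z).mul h1.exp).congr_deriv ?_
  rw [hermiteR_succ, Polynomial.derivative_mul]
  simp only [Polynomial.eval_add, Polynomial.eval_mul, Polynomial.eval_sub, Polynomial.eval_X]
  ring

lemma integral_hermiteR_mul_hermiteR (j k : ℕ) :
    ∫ z : ℝ, (hermiteR j * hermiteR k).eval z * Real.exp (-z ^ 2 / 2)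
      = if j = k then Real.sqrt (2 * Real.pi) * (Nat.factorial k : ℝ) else 0 := by
  induction j generalizing k with
  | zero =>
    cases k with
    | zero =>
      have h := integral_gaussian (1 / 2)
      simp only [hermiteR_zero, mul_one, Polynomial.eval_one, one_mul, if_true,
        Nat.factorial_zero, Nat.cast_one]
      rw [show 2 * Real.pi = Real.pi / (1 / 2) by ring, ← h]
      congr 1 with z
      ring_nf
    | succ k =>
      rw [mul_comm, integral_hermiteR_succ_mul, hermiteR_zero]
      simp
  | succ j ih =>
    rw [integral_hermiteR_succ_mul]
    cases k with
    | zero => simp [hermiteR_zero]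
    | succ k =>
      rw [derivative_hermiteR_succ, mul_left_comm]
      simp only [Polynomial.eval_mul (p := Polynomial.C _), Polynomial.eval_C, mul_assoc]
      rw [integral_const_mul]
      simp only [Polynomial.eval_mul]
      simp only [Polynomial.eval_mul] at ih
      rw [ih]
      simp only [Nat.succ_inj]
      split_ifs
      · rw [Nat.factorial_succ]
        push_cast
        ring
      · simp

/-- The density of the centred normal distribution with standard deviation `α`. -/
def gaussWeight (α x : ℝ) : ℝ :=
  (Real.sqrt (2 * Real.pi) * α)⁻¹ * Real.exp (-x ^ 2 / (2 * α ^ 2))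

lemma hermProd_mul_gaussWeight {b c ℓ α : ℝ} (hℓ : 0 < ℓ) (hα : 0 < α)
    (hc : 1 - b + (ℓ / α) ^ 2 = c ^ 2) (j k : ℕ) (x : ℝ) :
    hermProd b c ℓ j k x * gaussWeight α x
      = ((Real.sqrt ((Nat.factorial j : ℝ) * Nat.factorial k))⁻¹ *
          (Real.sqrt (2 * Real.pi) * α)⁻¹) *
        ((hermiteR j * hermiteR k).eval (c / ℓ * x) * Real.exp (-(c / ℓ * x) ^ 2 / 2)) := by
  have h : -(c / ℓ * x) ^ 2 / 2
      = -((1 - b) * (x / ℓ) ^ 2) / 2 + -x ^ 2 / (2 * α ^ 2) := by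
    rw [mul_pow, div_pow, ← hc]
    field_simp
    ring
  rw [hermProd, gaussWeight, h, Real.exp_add, show c / ℓ * x = c * (x / ℓ) by ring]
  ring

lemma integrable_hermProd_mul_gaussWeight {b c ℓ α : ℝ} (hℓ : 0 < ℓ) (hα : 0 < α) (hc0 : 0 < c)
    (hc : 1 - b + (ℓ / α) ^ 2 = c ^ 2) (j k : ℕ) :
    Integrable fun x => hermProd b c ℓ j k x * gaussWeight α x := by
  simp only [hermProd_mul_gaussWeight hℓ hα hc]
  exact ((integrable_polynomial_mul_exp _).comp_mul_left' (div_pos hc0 hℓ).ne').const_mul _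

lemma integral_hermProd_mul_gaussWeight {b c ℓ α : ℝ} (hℓ : 0 < ℓ) (hα : 0 < α) (hc0 : 0 < c)
    (hc : 1 - b + (ℓ / α) ^ 2 = c ^ 2) (j k : ℕ) :
    ∫ x, hermProd b c ℓ j k x * gaussWeight α x = if j = k then ℓ / (c * α) else 0 := by
  simp only [hermProd_mul_gaussWeight hℓ hα hc]
  rw [integral_const_mul, Measure.integral_comp_mul_left
    (fun z => (hermiteR j * hermiteR k).eval z * Real.exp (-z ^ 2 / 2)),
    integral_hermiteR_mul_hermiteR]
  split_ifs with h
  · subst h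
    rw [Real.sqrt_mul_self (Nat.cast_nonneg _), abs_of_pos (inv_pos.2 (div_pos hc0 hℓ)),
      smul_eq_mul]
    have hπ : Real.sqrt (2 * Real.pi) ≠ 0 := (Real.sqrt_pos.2 (by positivity)).ne'
    have hj : (Nat.factorial j : ℝ) ≠ 0 := by positivity
    field_simp
  · simp

lemma integrable_gaussWeight {α : ℝ} (hα : 0 < α) : Integrable (gaussWeight α) := by
  have h := (integrable_exp_neg_mul_sq (b := 1 / (2 * α ^ 2)) (by positivity)).const_mul
    (Real.sqrt (2 * Real.pi) * α)⁻¹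
  refine h.congr (ae_of_all _ fun z => ?_)
  simp only [gaussWeight]
  congr 2
  ring

lemma IgaussD_eq {d : ℕ} (α : Fin d → ℝ) (f : (Fin d → ℝ) → ℝ) :
    IgaussD α f = ∫ x : Fin d → ℝ, f x * ∏ i, gaussWeight (α i) (x i) := rfl

lemma abs_IgaussD_le {d : ℕ} {α : Fin d → ℝ} (hα : ∀ i, 0 < α i) {f : (Fin d → ℝ) → ℝ}
    (hf : ∀ x, |f x| ≤ 1) :
    |IgaussD α f| ≤ ∫ x : Fin d → ℝ, ∏ i, gaussWeight (α i) (x i) := by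
  have hw : Integrable fun x : Fin d → ℝ => ∏ i, gaussWeight (α i) (x i) :=
    Integrable.fintype_prod fun i => integrable_gaussWeight (hα i)
  rw [IgaussD_eq, ← Real.norm_eq_abs]
  refine norm_integral_le_of_norm_le hw (ae_of_all _ fun x => ?_)
  have h0 : 0 ≤ ∏ i, gaussWeight (α i) (x i) := Finset.prod_nonneg fun i _ => by
    have := hα i
    rw [gaussWeight]
    positivity
  rw [norm_mul, Real.norm_eq_abs, Real.norm_eq_abs, abs_of_nonneg h0]
  exact mul_le_of_le_one_left h0 (hf x)

lemma abs_IgaussD_sub_le_wceD {d N : ℕ} {α ℓ : Fin d → ℝ} (hα : ∀ i, 0 < α i)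
    (hℓ : ∀ i, 0 < ℓ i) (x : Fin N → Fin d → ℝ) (w : Fin N → ℝ) {f : (Fin d → ℝ) → ℝ}
    (hf : InBallD ℓ f) :
    |IgaussD α f - ∑ i, w i * f (x i)| ≤ wceD α ℓ fun f => ∑ i, w i * f (x i) := by
  refine le_csSup ⟨(∫ x : Fin d → ℝ, ∏ i, gaussWeight (α i) (x i)) + ∑ i, |w i|, ?_⟩
    ⟨f, hf, rfl⟩
  rintro _ ⟨g, hg, rfl⟩
  refine (abs_sub _ _).trans (add_le_add (abs_IgaussD_le hα (hg.abs_le_one hℓ)) ?_)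
  refine (Finset.abs_sum_le_sum_abs _ _).trans (Finset.sum_le_sum fun i _ => ?_)
  rw [abs_mul]
  exact mul_le_of_le_one_right (abs_nonneg _) (hg.abs_le_one hℓ _)

lemma exists_ne_zero_sum_mul_eq_zero {κ : Type*} [Fintype κ] {N : ℕ} (h : N < Fintype.card κ)
    (P : κ → Fin N → ℝ) :
    ∃ a : κ → ℝ, ∃ k, (∀ i, ∑ j, a j * P j i = 0) ∧ a k = 1 ∧ ∀ j, |a j| ≤ 1 := by
  have hker := LinearMap.ker_ne_bot_of_finrank_lt (f := Fintype.linearCombination ℝ P)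
    (by simpa using h)
  obtain ⟨a, ha, ha0⟩ := Submodule.exists_mem_ne_zero_of_ne_bot hker
  obtain ⟨k0, hk0⟩ := Function.ne_iff.1 ha0
  obtain ⟨k, -, hk⟩ := Finset.exists_max_image Finset.univ (fun j => |a j|) ⟨k0, Finset.mem_univ _⟩
  have hak : 0 < |a k| := (abs_pos.2 hk0).trans_le (hk k0 (Finset.mem_univ _))
  refine ⟨fun j => a j / a k, k, fun i => ?_, div_self (abs_pos.1 hak), fun j => ?_⟩
  · have hi := congrFun (LinearMap.mem_ker.1 ha) i
    simp only [Fintype.linearCombination_apply, Finset.sum_apply, Pi.smul_apply, smul_eq_mul,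
      Pi.zero_apply] at hi
    simp only [div_mul_eq_mul_div, ← Finset.sum_div, hi, zero_div]
  · rw [abs_div, div_le_one hak]
    exact hk j (Finset.mem_univ _)

lemma hermProd_eq_mul (b c ℓ : ℝ) (j k : ℕ) (x : ℝ) :
    hermProd b c ℓ j k x = (Real.sqrt (Nat.factorial j : ℝ))⁻¹ * (hermiteR j).eval (c * (x / ℓ)) *
      ((Real.sqrt (Nat.factorial k : ℝ))⁻¹ * (hermiteR k).eval (c * (x / ℓ)) *
        Real.exp (-((1 - b) * (x / ℓ) ^ 2) / 2)) := by
  rw [hermProd, Real.sqrt_mul (Nat.cast_nonneg _), Polynomial.eval_mul, mul_inv]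
  ring

lemma exists_expansionBound_vanishing {b c ℓ α : ℝ} (hb0 : 0 < b) (hb : b < 1)
    (hbc : b * c ^ 2 = 1 - b ^ 2) (hc0 : 0 < c) (hc : 1 - b + (ℓ / α) ^ 2 = c ^ 2) (hℓ : 0 < ℓ)
    (hα : 0 < α) {d n N : ℕ} (hN : N < (n + 1) ^ d) (x : Fin N → Fin d → ℝ) :
    ∃ f, ExpansionBound (fun (m : Fin d → ℕ) (x : Fin d → ℝ) => ∏ i, phi ℓ (m i) (x i)) f
        ((n + 1) ^ d * ((3 / b) ^ n * Real.sqrt (1 / (1 - b ^ 2) ^ (1 / 2 : ℝ))) ^ d) ∧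
      (∀ i, f (x i) = 0) ∧ IgaussD (fun _ : Fin d => α) f = (ℓ / (c * α)) ^ d := by
  obtain ⟨a, k, ha, hak, ha1⟩ := exists_ne_zero_sum_mul_eq_zero (κ := Fin d → Fin (n + 1))
    (by simpa using hN) fun j i => ∏ s, ((Real.sqrt (Nat.factorial (j s) : ℝ))⁻¹ *
      (hermiteR (j s)).eval (c * (x i s / ℓ)))
  have hB : 0 ≤ (3 / b) ^ n * Real.sqrt (1 / (1 - b ^ 2) ^ (1 / 2 : ℝ)) := by positivity
  refine ⟨fun y => ∑ j, a j * ∏ s, hermProd b c ℓ (j s) (k s) (y s), ?_, fun i => ?_, ?_⟩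
  · refine (ExpansionBound.sum Finset.univ fun j _ => (ExpansionBound.pi_prod fun s =>
      expansionBound_hermProd hb0 hb hbc hℓ (Nat.lt_succ_iff.1 (j s).2)
        (Nat.lt_succ_iff.1 (k s).2)).const_mul (a j)).mono ?_
    rw [Finset.prod_const, Finset.card_univ, Fintype.card_fin, ← Finset.sum_mul]
    gcongr
    refine (Finset.sum_le_sum fun j _ => ha1 j).trans (le_of_eq ?_)
    simp
  · refine (Finset.sum_congr rfl fun j _ => ?_).trans ((Finset.sum_mul _ _ (∏ s,
      ((Real.sqrt (Nat.factorial (k s) : ℝ))⁻¹ * (hermiteR (k s)).eval (c * (x i s / ℓ)) *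
        Real.exp (-((1 - b) * (x i s / ℓ) ^ 2) / 2)))).symm.trans (by rw [ha i, zero_mul]))
    rw [mul_assoc, ← Finset.prod_mul_distrib]
    simp only [hermProd_eq_mul]
  · have hint : ∀ j : Fin d → Fin (n + 1), Integrable fun y : Fin d → ℝ =>
        ∏ s, hermProd b c ℓ (j s) (k s) (y s) * gaussWeight α (y s) := fun j =>
      Integrable.fintype_prod fun s =>
        integrable_hermProd_mul_gaussWeight hℓ hα hc0 hc (j s) (k s)
    rw [IgaussD_eq]
    simp only [Finset.sum_mul, mul_assoc, ← Finset.prod_mul_distrib]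
    rw [integral_finsetSum _ fun j _ => (hint j).const_mul (a j)]
    simp only [integral_const_mul]
    rw [Finset.sum_eq_single k]
    · rw [integral_fintype_prod_volume_eq_prod
        (fun s y => hermProd b c ℓ (k s) (k s) y * gaussWeight α y), hak]
      simp only [integral_hermProd_mul_gaussWeight hℓ hα hc0 hc, if_true, Finset.prod_const,
        Finset.card_univ, Fintype.card_fin, one_mul]
    · intro j _ hjk
      obtain ⟨s, hs⟩ := Function.ne_iff.1 hjk
      rw [integral_fintype_prod_volume_eq_prod
        (fun s y => hermProd b c ℓ (j s) (k s) y * gaussWeight α y),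
        Finset.prod_eq_zero (Finset.mem_univ s), mul_zero]
      rw [integral_hermProd_mul_gaussWeight hℓ hα hc0 hc, if_neg fun h => hs (Fin.ext h)]
    · simp

lemma omegaP_pos {γ : ℝ} (hγ : 0 < γ) : 0 < omegaP γ := by
  rw [omegaP]
  positivity

lemma omegaP_lt_one (γ : ℝ) : omegaP γ < 1 := by
  rw [omegaP, div_lt_one (by positivity)]
  linarith [Real.sqrt_nonneg (1 + 4 * γ ^ 2)]

lemma omegaP_le {γ : ℝ} : omegaP γ ≤ γ ^ 2 / (1 + γ ^ 2) := by
  have h1 : 1 ≤ Real.sqrt (1 + 4 * γ ^ 2) := Real.one_le_sqrt.2 (by nlinarith [sq_nonneg γ])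
  rw [omegaP, div_le_div_iff₀ (by positivity) (by positivity)]
  nlinarith [mul_nonneg (sq_nonneg γ) (sub_nonneg.2 h1)]

lemma three_pow_mul_factorial_le {n : ℕ} (hn : 1 ≤ n) :
    (3 : ℝ) ^ n * Nat.factorial n ≤ Real.sqrt (Real.exp 1) * Nat.factorial (2 * n) := by
  induction n, hn using Nat.le_induction with
  | base =>
    have h : (3 / 2 : ℝ) ≤ Real.sqrt (Real.exp 1) :=
      Real.le_sqrt_of_sq_le (by linarith [Real.exp_one_gt_d9])
    simp only [Nat.factorial]
    norm_num
    linarith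
  | succ n hn ih =>
    rw [show 2 * (n + 1) = 2 * n + 1 + 1 by ring, Nat.factorial_succ, Nat.factorial_succ,
      Nat.factorial_succ, pow_succ]
    push_cast
    have hn' : (1 : ℝ) ≤ n := by exact_mod_cast hn
    calc (3 : ℝ) ^ n * 3 * (((n : ℝ) + 1) * Nat.factorial n)
        = 3 * ((n : ℝ) + 1) * (3 ^ n * Nat.factorial n) := by ring
      _ ≤ (2 * (n : ℝ) + 1 + 1) * (2 * n + 1) *
          (Real.sqrt (Real.exp 1) * Nat.factorial (2 * n)) := by
        refine mul_le_mul ?_ ih (by positivity) (by positivity)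
        nlinarith
      _ = _ := by ring

lemma Cbar_nonneg (γ : ℝ) (n : ℕ) : 0 ≤ Cbar γ n := by
  rw [Cbar]
  positivity

lemma Cbar_mul_pow {γ : ℝ} {n : ℕ} (hn : 1 ≤ n) (ω : ℝ) :
    Cbar γ n * (ω * Real.exp 1 / (4 * (n : ℝ))) ^ n
      = Real.sqrt (2 * (1 + 4 * γ ^ 2) ^ ((1 : ℝ) / 4) /
          ((1 + 2 * γ ^ 2 + Real.sqrt (1 + 4 * γ ^ 2)) * Real.exp 1)) *
        ((Nat.factorial n : ℝ) / (Nat.factorial (2 * n) : ℝ)) * ω ^ n := by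
  have hn' : (0 : ℝ) < n := by exact_mod_cast hn
  have h : Real.exp 1 / (4 * (n : ℝ)) ≠ 0 := by positivity
  rw [Cbar, mul_div_assoc ω, mul_pow ω, zpow_neg, zpow_natCast]
  field_simp

lemma sqrt_rpow_half_pow_four {y : ℝ} (hy : 0 ≤ y) : Real.sqrt (y ^ (1 / 2 : ℝ)) ^ 4 = y := by
  rw [show 4 = 2 * 2 by norm_num, pow_mul, Real.sq_sqrt (by positivity), ← Real.rpow_natCast,
    ← Real.rpow_mul hy]
  norm_num

lemma Cbar_const_mul_le {γ b c : ℝ} (hγ : 0 < γ) (hb : b = γ ^ 2 / (1 + γ ^ 2)) (hc0 : 0 < c)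
    (hbc : b * c ^ 2 = 1 - b ^ 2) :
    Real.sqrt (2 * (1 + 4 * γ ^ 2) ^ ((1 : ℝ) / 4) /
          ((1 + 2 * γ ^ 2 + Real.sqrt (1 + 4 * γ ^ 2)) * Real.exp 1)) *
        (Real.sqrt (1 / (1 - b ^ 2) ^ (1 / 2 : ℝ)) * (c * γ)) ≤ (Real.sqrt (Real.exp 1))⁻¹ := by
  have hb2 : 1 - b ^ 2 = (1 + 2 * γ ^ 2) / (1 + γ ^ 2) ^ 2 := by
    rw [hb]
    field_simp
    ring
  have hcγ : (c * γ) ^ 2 = (1 + 2 * γ ^ 2) / (1 + γ ^ 2) := by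
    have : (c * γ) ^ 2 = (b * c ^ 2) * (1 + γ ^ 2) := by
      rw [hb]
      field_simp
    rw [this, hbc, hb2]
    field_simp
  have hpos : 0 < 1 - b ^ 2 := by rw [hb2]; positivity
  have hX : (Real.sqrt (1 / (1 - b ^ 2) ^ (1 / 2 : ℝ)) * (c * γ)) ^ 4 = 1 + 2 * γ ^ 2 := by
    rw [mul_pow, Real.sqrt_div zero_le_one, Real.sqrt_one, div_pow, one_pow,
      sqrt_rpow_half_pow_four hpos.le, show 4 = 2 * 2 by norm_num, pow_mul, hcγ, hb2]
    field_simp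
  set s := Real.sqrt (1 + 4 * γ ^ 2)
  have hs : s ^ 2 = 1 + 4 * γ ^ 2 := Real.sq_sqrt (by positivity)
  have hs0 : 0 ≤ s := Real.sqrt_nonneg _
  have hr : ((1 + 4 * γ ^ 2) ^ ((1 : ℝ) / 4)) ^ 2 = s := by
    rw [← pow_left_inj₀ (by positivity) hs0 two_ne_zero, ← pow_mul, hs,
      ← Real.rpow_natCast, ← Real.rpow_mul (by positivity)]
    norm_num
  refine (pow_le_pow_iff_left₀ (by positivity) (by positivity) four_ne_zero).1 ?_
  rw [mul_pow, hX, inv_pow, show 4 = 2 * 2 by norm_num, pow_mul, pow_mul,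
    Real.sq_sqrt (by positivity), Real.sq_sqrt (by positivity), div_pow, mul_pow, hr, mul_pow,
    div_mul_eq_mul_div, div_le_iff₀ (by positivity), ← mul_assoc, mul_comm _ (Real.exp 1 ^ 2),
    ← mul_assoc, mul_inv_cancel₀ (by positivity)]
  nlinarith [sq_nonneg (1 + 2 * γ ^ 2 - s)]

lemma Cbar_mul_pow_mul_le_one {γ b c : ℝ} (hγ : 0 < γ) (hb : b = γ ^ 2 / (1 + γ ^ 2))
    (hc0 : 0 < c) (hbc : b * c ^ 2 = 1 - b ^ 2) {n : ℕ} (hn : 1 ≤ n) :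
    Cbar γ n * (omegaP γ * Real.exp 1 / (4 * (n : ℝ))) ^ n *
      ((3 / b) ^ n * Real.sqrt (1 / (1 - b ^ 2) ^ (1 / 2 : ℝ)) * (c * γ)) ≤ 1 := by
  have hb0 : 0 < b := by rw [hb]; positivity
  have hω : 0 ≤ omegaP γ / b := div_nonneg (omegaP_pos hγ).le hb0.le
  have hω1 : omegaP γ / b ≤ 1 := (div_le_one hb0).2 (hb ▸ omegaP_le)
  have hK := Cbar_const_mul_le hγ hb hc0 hbc
  have hF : (Nat.factorial n : ℝ) / (Nat.factorial (2 * n) : ℝ) * 3 ^ n * (omegaP γ / b) ^ n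
      ≤ Real.sqrt (Real.exp 1) := by
    refine (mul_le_of_le_one_right (by positivity) (pow_le_one₀ hω hω1)).trans ?_
    rw [div_mul_eq_mul_div, div_le_iff₀ (by positivity), mul_comm (Nat.factorial n : ℝ)]
    exact three_pow_mul_factorial_le hn
  rw [Cbar_mul_pow hn]
  have hF0 : 0 ≤ (Nat.factorial n : ℝ) / (Nat.factorial (2 * n) : ℝ) * 3 ^ n *
    (omegaP γ / b) ^ n := by positivity
  calc _ = _ * ((Nat.factorial n : ℝ) / (Nat.factorial (2 * n) : ℝ) * 3 ^ n *
        (omegaP γ / b) ^ n) := by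
        rw [div_pow 3, div_pow (omegaP γ)]
        ring
    _ ≤ _ := mul_le_mul hK hF hF0 (by positivity)
    _ = 1 := inv_mul_cancel₀ (Real.sqrt_pos.2 (Real.exp_pos 1)).ne'

lemma div_pow_le_wceD {α ℓ : ℝ} (hα : 0 < α) (hℓ : 0 < ℓ) {b c : ℝ}
    (hb : b = (α / ℓ) ^ 2 / (1 + (α / ℓ) ^ 2)) (hc0 : 0 < c) (hbc : b * c ^ 2 = 1 - b ^ 2)
    {d n N : ℕ} (hN : N < (n + 1) ^ d) (x : Fin N → Fin d → ℝ) (w : Fin N → ℝ) :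
    (((n : ℝ) + 1) ^ d)⁻¹ *
        (((3 / b) ^ n * Real.sqrt (1 / (1 - b ^ 2) ^ (1 / 2 : ℝ)) * (c * (α / ℓ)))⁻¹) ^ d
      ≤ wceD (fun _ : Fin d => α) (fun _ => ℓ) (fun f => ∑ i, w i * f (x i)) := by
  have hb0 : 0 < b := by rw [hb]; positivity
  have hb1 : b < 1 := by
    rw [hb, div_lt_one (by positivity)]
    linarith
  have hc : 1 - b + (ℓ / α) ^ 2 = c ^ 2 := by
    rw [← mul_right_inj' hb0.ne', hbc, hb]
    field_simp
    ring
  obtain ⟨f, hf, hfx, hI⟩ := exists_expansionBound_vanishing hb0 hb1 hbc hc0 hc hℓ hα hN x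
  have hb2 : 0 < 1 - b ^ 2 := by nlinarith
  set B := (3 / b) ^ n * Real.sqrt (1 / (1 - b ^ 2) ^ (1 / 2 : ℝ))
  have hB : 0 < B := mul_pos (by positivity) (Real.sqrt_pos.2 (by positivity))
  set M := ((n : ℝ) + 1) ^ d * B ^ d with hM
  have hM0 : 0 < M := by positivity
  have hball : InBallD (fun _ : Fin d => ℓ) fun y => M⁻¹ * f y :=
    ((hf.const_mul M⁻¹).mono (by
      rw [abs_of_pos (inv_pos.2 hM0), inv_mul_cancel₀ hM0.ne'])).inBallD
  have h := abs_IgaussD_sub_le_wceD (fun _ => hα) (fun _ => hℓ) x w hball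
  have hI' : IgaussD (fun _ : Fin d => α) (fun y => M⁻¹ * f y) = M⁻¹ * (ℓ / (c * α)) ^ d := by
    rw [← hI, IgaussD_eq, IgaussD_eq, ← integral_const_mul]
    simp only [mul_assoc]
  simp only [hfx, mul_zero, Finset.sum_const_zero, sub_zero, hI'] at h
  refine le_trans (le_of_eq ?_) ((le_abs_self _).trans h)
  rw [hM, mul_inv B, mul_inv (_ ^ d), ← inv_pow B, mul_assoc, ← mul_pow]
  congr 2
  field_simp

lemma lower_bound_decay {d n N : ℕ} (hd : 0 < d) (hN : N + 1 = (n + 1) ^ d) (hn : 1 ≤ n) {T : ℝ}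
    (hT : 0 < T) (hT4 : T ≤ 4) :
    ((4 / T) ^ d : ℝ) ^ (-(((N : ℝ) + 1) ^ ((1 : ℝ) / (d : ℝ)))) *
        ((N : ℝ) + 1) ^ (-(((N : ℝ) + 1) ^ ((1 : ℝ) / (d : ℝ)) + 1))
      ≤ ((N : ℝ) + 1)⁻¹ * (T / (4 * (n : ℝ))) ^ (d * n) := by
  have hn' : (0 : ℝ) < n := by exact_mod_cast hn
  have hN' : (N : ℝ) + 1 = ((n : ℝ) + 1) ^ d := by exact_mod_cast hN
  have hroot : ((N : ℝ) + 1) ^ ((1 : ℝ) / (d : ℝ)) = ((n + 1 : ℕ) : ℝ) := by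
    rw [hN', one_div, Real.pow_rpow_inv_natCast (by positivity) hd.ne']
    push_cast
    rfl
  have h1 : 1 ≤ 4 / T := (one_le_div hT).2 hT4
  have hpow : (n : ℝ) ^ n ≤ ((n : ℝ) + 1) ^ (n + 1) :=
    (pow_le_pow_left₀ hn'.le (by linarith) n).trans (pow_le_pow_right₀ (by linarith) n.le_succ)
  rw [hroot, Real.rpow_neg (by positivity), Real.rpow_natCast, ← Nat.cast_succ (n + 1),
    Real.rpow_neg (by positivity), Real.rpow_natCast, ← mul_inv]
  have e : ((N : ℝ) + 1)⁻¹ * (T / (4 * (n : ℝ))) ^ (d * n)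
      = (((4 / T) ^ d) ^ n * (((N : ℝ) + 1) * ((n : ℝ) ^ n) ^ d))⁻¹ := by
    rw [← pow_mul, ← pow_mul, mul_comm n d, mul_left_comm, ← mul_pow, mul_inv, ← inv_pow]
    congr 2
    field_simp
  rw [e]
  refine inv_anti₀ (by positivity) (mul_le_mul ?_ ?_ (by positivity) (by positivity))
  · exact pow_le_pow_right₀ (one_le_pow₀ h1) n.le_succ
  · rw [Nat.succ_eq_add_one, pow_succ' _ (n + 1), hN', pow_right_comm _ d]
    gcongr

/-- lower bound for the worst-case error of any N-point rule in the isotropic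
case with N + 1 = (n+1)^d. -/
theorem stmt19 (d : ℕ) (hd : 0 < d) (α ℓ : ℝ) (hα : 0 < α) (hℓ : 0 < ℓ)
    (n N : ℕ) (hn : 1 ≤ n) (hN : 1 ≤ N) (hNd : N + 1 = (n + 1) ^ d)
    (x : Fin N → Fin d → ℝ) (w : Fin N → ℝ) :
    (1 : ℝ) < (4 / (omegaP (α / ℓ) * Real.exp 1)) ^ d ∧
    Cbar (α / ℓ) n ^ d * ((N : ℝ) + 1)⁻¹ *
        (omegaP (α / ℓ) * Real.exp 1 / (4 * (n : ℝ))) ^ (d * n)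
      ≤ wceD (fun _ : Fin d => α) (fun _ => ℓ) (fun f => ∑ i, w i * f (x i)) ∧
    Cbar (α / ℓ) n ^ d *
        ((4 / (omegaP (α / ℓ) * Real.exp 1)) ^ d : ℝ) ^
          (-(((N : ℝ) + 1) ^ ((1 : ℝ) / (d : ℝ)))) *
        ((N : ℝ) + 1) ^ (-(((N : ℝ) + 1) ^ ((1 : ℝ) / (d : ℝ)) + 1))
      ≤ Cbar (α / ℓ) n ^ d * ((N : ℝ) + 1)⁻¹ *
          (omegaP (α / ℓ) * Real.exp 1 / (4 * (n : ℝ))) ^ (d * n) := by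
  have hγ : 0 < α / ℓ := div_pos hα hℓ
  have hω := omegaP_pos hγ
  have hT : 0 < omegaP (α / ℓ) * Real.exp 1 := by positivity
  have hT4 : omegaP (α / ℓ) * Real.exp 1 < 4 :=
    (mul_lt_of_lt_one_left (Real.exp_pos 1) (omegaP_lt_one _)).trans
      (Real.exp_one_lt_d9.trans (by norm_num))
  refine ⟨one_lt_pow₀ ((one_lt_div hT).2 hT4) hd.ne', ?_, ?_⟩
  · obtain ⟨b, hb⟩ : ∃ b : ℝ, b = (α / ℓ) ^ 2 / (1 + (α / ℓ) ^ 2) := ⟨_, rfl⟩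
    have hb0 : 0 < b := by rw [hb]; positivity
    have hb1 : b < 1 := by
      rw [hb, div_lt_one (by positivity)]
      linarith
    have hb2 : 0 < 1 - b ^ 2 := by nlinarith
    have hc0 : 0 < Real.sqrt ((1 - b ^ 2) / b) := Real.sqrt_pos.2 (by positivity)
    have hbc : b * Real.sqrt ((1 - b ^ 2) / b) ^ 2 = 1 - b ^ 2 := by
      rw [Real.sq_sqrt (by positivity), mul_div_cancel₀ _ hb0.ne']
    refine le_trans ?_ (div_pow_le_wceD hα hℓ hb hc0 hbc (n := n) (by omega) x w)
    have h := Cbar_mul_pow_mul_le_one hγ hb hc0 hbc hn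
    rw [show ((N : ℝ) + 1) = ((n : ℝ) + 1) ^ d by exact_mod_cast hNd, mul_comm d n, pow_mul,
      mul_right_comm, ← mul_pow, mul_comm]
    have hC := Cbar_nonneg (α / ℓ) n
    gcongr
    rw [← one_div, le_div_iff₀ ?_]
    · exact h
    · have := Real.sqrt_pos.2 (show 0 < 1 / (1 - b ^ 2) ^ (1 / 2 : ℝ) by positivity)
      positivity
  · rw [mul_assoc, mul_assoc]
    exact mul_le_mul_of_nonneg_left (lower_bound_decay hd hNd hn hT hT4.le)
      (pow_nonneg (Cbar_nonneg _ _) _)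

end
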